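/- Let p ≥ 1 and ν ≥ 1 be integers, R > 0, and ζ ∈ (0,π). Then Σ_{j=0}^∞ (2j+ν) I_{p(2j+ν)}(R) C_{2j}^ν(cos ζ) = (1/(2^{ν+1} (ν−1)! p)) · Σ_{σ=1}^{2p} (−1)^{νσ} · L^ν[ ζ ↦ exp( R cos((ζ+σπ)/p) ) ](ζ). -/

import Mathlib

/-- Modified Bessel function of the first kind of real order `α ≥ 0`. -/
noncomputable def besselI (α R : ℝ) : ℝ :=
  ∑' m : ℕ, (R / 2) ^ (2 * (m : ℝ) + α) / (Nat.factorial m * Real.Gamma ((m : ℝ) + α + 1))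

/-- Gegenbauer polynomial `C_j^ν(x)` for real `ν > 0`. -/
noncomputable def gegenbauerC (ν : ℝ) (j : ℕ) (x : ℝ) : ℝ :=
  ∑ k ∈ Finset.range (j / 2 + 1),
    (-1 : ℝ) ^ k * Real.Gamma (ν + (j : ℝ) - (k : ℝ)) /
      (Real.Gamma ν * Nat.factorial k * Nat.factorial (j - 2 * k)) * (2 * x) ^ (j - 2 * k)

/-- The operator `L g (ζ) = - g'(ζ) / sin ζ`. -/
noncomputable def Lop (g : ℝ → ℝ) : ℝ → ℝ := fun ζ => -(deriv g ζ) / Real.sin ζ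

open Polynomial

/-- At natural order, each coefficient of the Bessel series splits into two exponential ones. -/
theorem besselI_natCast (n : ℕ) (R : ℝ) :
    besselI n R = ∑' m : ℕ, (R / 2) ^ m / (m.factorial : ℝ) *
      ((R / 2) ^ (m + n) / ((m + n).factorial : ℝ)) := by
  unfold besselI
  refine tsum_congr fun m => ?_
  have h1 : (m : ℝ) + n + 1 = ((m + n : ℕ) : ℝ) + 1 := by push_cast; ring
  have h2 : (2 : ℝ) * m + n = ((m + (m + n) : ℕ) : ℝ) := by push_cast; ring
  rw [h1, Real.Gamma_nat_eq_factorial, h2, Real.rpow_natCast, pow_add, mul_div_mul_comm]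

/-- Pairs of naturals, indexed by their difference and their minimum. -/
def natProdEquivIntProd : ℕ × ℕ ≃ ℤ × ℕ where
  toFun x := ((x.1 : ℤ) - x.2, min x.1 x.2)
  invFun y := (y.2 + y.1.toNat, y.2 + (-y.1).toNat)
  left_inv x := by ext <;> simp <;> omega
  right_inv y := by ext <;> simp; omega

theorem hasSum_mul_of_complex {f g : ℕ → ℂ} {a b : ℂ} (hf : HasSum f a) (hg : HasSum g b) :
    HasSum (fun x : ℕ × ℕ => f x.1 * g x.2) (a * b) := by
  have h := summable_mul_of_summable_norm hf.summable.norm hg.summable.norm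
  exact hf.mul hg h

/-- The Laurent expansion `exp (R / 2 * (w + w⁻¹)) = ∑ₙ Iₙ(R) wⁿ`. -/
theorem hasSum_besselI_mul_zpow (R : ℝ) {w : ℂ} (hw : w ≠ 0) :
    HasSum (fun n : ℤ => (besselI n.natAbs R : ℂ) * w ^ n) (Complex.exp (R / 2 * (w + w⁻¹))) := by
  have hf (z : ℂ) : HasSum (fun a : ℕ => z ^ a / (a.factorial : ℂ)) (Complex.exp z) := by
    have h := NormedSpace.expSeries_div_hasSum_exp z
    rwa [← Complex.exp_eq_exp_ℂ] at h
  have hprod : HasSum (fun x : ℕ × ℕ => (R / 2 * w) ^ x.1 / (x.1.factorial : ℂ) *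
      ((R / 2 * w⁻¹) ^ x.2 / (x.2.factorial : ℂ))) (Complex.exp (R / 2 * (w + w⁻¹))) := by
    rw [mul_add, Complex.exp_add]
    have h := hasSum_mul_of_complex (hf (R / 2 * w)) (hf (R / 2 * w⁻¹))
    exact h
  rw [← natProdEquivIntProd.symm.hasSum_iff] at hprod
  have hfib (n : ℤ) (m : ℕ) : ((fun x : ℕ × ℕ => (R / 2 * w) ^ x.1 / (x.1.factorial : ℂ) *
      ((R / 2 * w⁻¹) ^ x.2 / (x.2.factorial : ℂ))) ∘ natProdEquivIntProd.symm) (n, m) =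
      (((R / 2) ^ m / (m.factorial : ℝ) *
      ((R / 2) ^ (m + n.natAbs) / ((m + n.natAbs).factorial : ℝ)) : ℝ) : ℂ) * w ^ n := by
    rcases Int.eq_nat_or_neg n with ⟨k, rfl | rfl⟩
    · simp [natProdEquivIntProd, mul_pow, pow_add]
      field_simp
    · simp [natProdEquivIntProd, mul_pow, pow_add]
      field_simp
  refine hprod.prod_fiberwise fun n => ?_
  have hs := (hprod.summable.prod_factor n).hasSum
  simp only [hfib] at hs ⊢
  rwa [tsum_mul_right, ← Complex.ofReal_tsum, ← besselI_natCast] at hs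

/-- Bessel functions decay superexponentially in the order. -/
theorem summable_besselI_mul_pow (R : ℝ) {K : ℝ} (hK : 1 ≤ K) :
    Summable fun n : ℤ => |besselI n.natAbs R| * K ^ n.natAbs := by
  have h (w : ℂ) (hw : w ≠ 0) := (hasSum_besselI_mul_zpow R hw).summable.norm
  have hK0 : 0 < K := by linarith
  refine Summable.of_nonneg_of_le (fun n => by positivity) (fun n => ?_)
    ((h (K : ℂ) (by exact_mod_cast hK0.ne')).add (h ((K : ℂ)⁻¹) (by simpa using hK0.ne')))
  simp only [norm_mul, norm_zpow, norm_inv, Complex.norm_real, Real.norm_eq_abs, abs_of_pos hK0]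
  rw [← mul_add]
  refine mul_le_mul_of_nonneg_left ?_ (abs_nonneg _)
  rcases Int.eq_nat_or_neg n with ⟨k, rfl | rfl⟩ <;> simp <;> positivity

theorem abs_eval_iterate_derivative_T_nat_le {K : ℕ} {x : ℝ} (hx : |x| ≤ 1) (n : ℕ) :
    ∀ k ≤ K, |(derivative^[k] (Chebyshev.T ℝ n)).eval x| ≤ (2 * K + 3 : ℝ) ^ n := by
  induction n using Nat.twoStepInduction with
  | zero =>
    intro k _
    rcases k with _ | k
    · simp
    · simp [Function.iterate_succ_apply]
  | one =>
    intro k _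
    have hK : (0 : ℝ) ≤ K := K.cast_nonneg
    rcases k with _ | _ | k
    · simp; linarith
    · simp; linarith
    · simp [Function.iterate_succ_apply]; positivity
  | more n h0 h1 =>
    intro k hk
    have hK : (0 : ℝ) ≤ K := K.cast_nonneg
    set B : ℝ := 2 * K + 3 with hB
    have hrec : derivative^[k] (Chebyshev.T ℝ ((n + 2 : ℕ) : ℤ)) =
        2 * (X * derivative^[k] (Chebyshev.T ℝ ((n + 1 : ℕ) : ℤ)) +
          k • derivative^[k - 1] (Chebyshev.T ℝ ((n + 1 : ℕ) : ℤ))) -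
        derivative^[k] (Chebyshev.T ℝ (n : ℤ)) := by
      push_cast
      rw [Chebyshev.T_add_two, iterate_derivative_sub, mul_assoc,
        show (2 : ℝ[X]) = C 2 from rfl, iterate_derivative_C_mul, mul_comm X, iterate_derivative_mul_X, mul_comm _ X]
    rw [hrec]
    have e0 := h0 k hk
    have e1 := h1 k hk
    have e2 := h1 (k - 1) (by omega)
    have hmono : B ^ n ≤ B ^ (n + 1) := pow_le_pow_right₀ (by linarith) (by omega)
    have hkK : (k : ℝ) ≤ K := by exact_mod_cast hk
    simp only [eval_sub, eval_mul, eval_add, eval_X, eval_ofNat, nsmul_eq_mul, eval_natCast]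
    have t1 : |x * (derivative^[k] (Chebyshev.T ℝ ((n + 1 : ℕ) : ℤ))).eval x| ≤ B ^ (n + 1) := by
      rw [abs_mul]
      calc _ ≤ 1 * B ^ (n + 1) := mul_le_mul hx e1 (abs_nonneg _) zero_le_one
        _ = _ := one_mul _
    have t2 : |(k : ℝ) * (derivative^[k - 1] (Chebyshev.T ℝ ((n + 1 : ℕ) : ℤ))).eval x|
        ≤ K * B ^ (n + 1) := by
      rw [abs_mul, Nat.abs_cast]
      exact mul_le_mul hkK e2 (abs_nonneg _) hK
    have hpow : B ^ (n + 2) = 2 * (B ^ (n + 1) + K * B ^ (n + 1)) + B ^ (n + 1) := by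
      rw [pow_succ B (n + 1), hB]; ring
    rw [abs_le] at *
    constructor <;> linarith [t1.1, t1.2, t2.1, t2.2, e0.1, e0.2]

/-- Derivatives of Chebyshev polynomials on `[-1, 1]` grow at most exponentially in the degree. -/
theorem abs_eval_iterate_derivative_T_le (k : ℕ) {x : ℝ} (hx : |x| ≤ 1) (n : ℤ) :
    |(derivative^[k] (Chebyshev.T ℝ n)).eval x| ≤ (2 * k + 3 : ℝ) ^ n.natAbs := by
  rw [← Chebyshev.T_natAbs]
  exact abs_eval_iterate_derivative_T_nat_le hx _ k le_rfl

theorem gegenbauerC_eq_sum_choose (j : ℕ) (x : ℝ) :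
    gegenbauerC 1 j x = ∑ k ∈ Finset.range (j + 1),
      (-1 : ℝ) ^ k * ((j - k).choose k : ℝ) * (2 * x) ^ (j - 2 * k) := by
  unfold gegenbauerC
  have hsub : Finset.range (j / 2 + 1) ⊆ Finset.range (j + 1) :=
    Finset.range_mono (by omega)
  rw [← Finset.sum_subset hsub]
  · refine Finset.sum_congr rfl fun k hk => ?_
    have hk' : 2 * k ≤ j := by have := Finset.mem_range.1 hk; omega
    have h1 : (1 : ℝ) + j - k = ((j - k : ℕ) : ℝ) + 1 := by
      rw [Nat.cast_sub (by omega)]; ring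
    rw [h1, Real.Gamma_nat_eq_factorial, Real.Gamma_one,
      Nat.cast_choose ℝ (show k ≤ j - k by omega), show j - k - k = j - 2 * k by omega]
    ring
  · intro k hk hk'
    have h : j - k < k := by simp only [Finset.mem_range] at hk hk'; omega
    simp [Nat.choose_eq_zero_of_lt h]

/-- Chebyshev polynomials of the second kind are the Gegenbauer polynomials with `ν = 1`. -/
theorem eval_U_eq_gegenbauerC (j : ℕ) (x : ℝ) :
    (Chebyshev.U ℝ j).eval x = gegenbauerC 1 j x := by
  simp only [gegenbauerC_eq_sum_choose]
  induction j using Nat.twoStepInduction with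
  | zero => simp
  | one => simp [Finset.sum_range_succ]
  | more n h0 h1 =>
    have hrec : (Chebyshev.U ℝ ((n + 2 : ℕ) : ℤ)).eval x =
        2 * x * (Chebyshev.U ℝ ((n + 1 : ℕ) : ℤ)).eval x - (Chebyshev.U ℝ (n : ℤ)).eval x := by
      push_cast
      simp [Chebyshev.U_add_two]
    rw [hrec, h0, h1, Finset.sum_range_succ' _ (n + 2), Finset.sum_range_succ' _ (n + 1),
      Finset.sum_range_succ _ (n + 1)]
    have key : ∀ k ∈ Finset.range (n + 1),
        (-1 : ℝ) ^ (k + 1) * ((n + 2 - (k + 1)).choose (k + 1) : ℝ) *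
          (2 * x) ^ (n + 2 - 2 * (k + 1)) =
        2 * x * ((-1 : ℝ) ^ (k + 1) * ((n + 1 - (k + 1)).choose (k + 1) : ℝ) *
          (2 * x) ^ (n + 1 - 2 * (k + 1))) -
        (-1 : ℝ) ^ k * ((n - k).choose k : ℝ) * (2 * x) ^ (n - 2 * k) := by
      intro k hk
      have hk' : k ≤ n := by have := Finset.mem_range.1 hk; omega
      rw [show n + 2 - (k + 1) = (n - k) + 1 by omega, show n + 1 - (k + 1) = n - k by omega,
        show n + 2 - 2 * (k + 1) = n - 2 * k by omega, Nat.choose_succ_succ]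
      rcases le_or_gt (2 * k + 1) n with h | h
      · rw [show n - 2 * k = (n + 1 - 2 * (k + 1)) + 1 by omega]
        push_cast; ring
      · rw [Nat.choose_eq_zero_of_lt (show n - k < k + 1 by omega)]
        push_cast; ring
    rw [Finset.sum_congr rfl key, Finset.sum_sub_distrib, ← Finset.mul_sum]
    simp only [show n + 2 - (n + 1 + 1) = 0 by omega, Nat.choose_zero_succ]
    simp
    ring

theorem hasDerivAt_gegenbauerC {ν : ℝ} (hν : 0 < ν) (j : ℕ) (x : ℝ) :
    HasDerivAt (gegenbauerC ν (j + 1)) (2 * ν * gegenbauerC (ν + 1) j x) x := by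
  have hterm (k : ℕ) : HasDerivAt (fun x : ℝ => (-1 : ℝ) ^ k *
      Real.Gamma (ν + ((j + 1 : ℕ) : ℝ) - (k : ℝ)) /
      (Real.Gamma ν * Nat.factorial k * Nat.factorial (j + 1 - 2 * k)) *
        (2 * x) ^ (j + 1 - 2 * k))
      ((-1 : ℝ) ^ k * Real.Gamma (ν + ((j + 1 : ℕ) : ℝ) - (k : ℝ)) /
      (Real.Gamma ν * Nat.factorial k * Nat.factorial (j + 1 - 2 * k)) *
        (((j + 1 - 2 * k : ℕ) : ℝ) * (2 * x) ^ (j + 1 - 2 * k - 1) * 2)) x := by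
    have h : HasDerivAt (fun x : ℝ => 2 * x) 2 x := by
      simpa using (hasDerivAt_id x).const_mul (2 : ℝ)
    exact (h.pow _).const_mul _
  have hsum := HasDerivAt.fun_sum (u := Finset.range ((j + 1) / 2 + 1)) fun k _ => hterm k
  have hfun : gegenbauerC ν (j + 1) = fun x => ∑ k ∈ Finset.range ((j + 1) / 2 + 1),
      (-1 : ℝ) ^ k * Real.Gamma (ν + ((j + 1 : ℕ) : ℝ) - (k : ℝ)) /
      (Real.Gamma ν * Nat.factorial k * Nat.factorial (j + 1 - 2 * k)) *
        (2 * x) ^ (j + 1 - 2 * k) := rfl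
  rw [hfun]
  refine hsum.congr_deriv (Eq.symm ?_)
  unfold gegenbauerC
  have hsub : Finset.range (j / 2 + 1) ⊆ Finset.range ((j + 1) / 2 + 1) :=
    Finset.range_mono (by omega)
  rw [Finset.mul_sum, ← Finset.sum_subset hsub]
  · refine Finset.sum_congr rfl fun k hk => ?_
    have hk' : 2 * k ≤ j := by have := Finset.mem_range.1 hk; omega
    rw [show j + 1 - 2 * k - 1 = j - 2 * k by omega, show j + 1 - 2 * k = j - 2 * k + 1 by omega,
      Nat.factorial_succ, Real.Gamma_add_one hν.ne']
    have h1 : ν + 1 + j - k = ν + ((j + 1 : ℕ) : ℝ) - k := by push_cast; ring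
    have h2 := (Real.Gamma_pos_of_pos hν).ne'
    rw [h1]
    push_cast
    have h3 : ((j - 2 * k : ℕ) : ℝ) + 1 ≠ 0 := by positivity
    field_simp
  · intro k hk hk'
    have h : j + 1 - 2 * k = 0 := by simp only [Finset.mem_range] at hk hk'; omega
    simp [h]

/-- The `ν`-th derivative of a Chebyshev polynomial is a multiple of a Gegenbauer polynomial. -/
theorem eval_iterate_derivative_T (ν j : ℕ) (x : ℝ) :
    (derivative^[ν + 1] (Chebyshev.T ℝ ((j + (ν + 1) : ℕ) : ℤ))).eval x =
      ((j + (ν + 1) : ℕ) : ℝ) * 2 ^ ν * (ν.factorial : ℝ) *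
        gegenbauerC ((ν + 1 : ℕ) : ℝ) j x := by
  induction ν generalizing j x with
  | zero =>
    have h : ((j + (0 + 1) : ℕ) : ℤ) - 1 = j := by push_cast; ring
    rw [Function.iterate_one, Chebyshev.T_derivative_eq_U, h, eval_mul, eval_U_eq_gegenbauerC]
    simp
  | succ ν ih =>
    rw [Function.iterate_succ_apply', show j + (ν + 1 + 1) = j + 1 + (ν + 1) by ring]
    have h1 := (derivative^[ν + 1] (Chebyshev.T ℝ ((j + 1 + (ν + 1) : ℕ) : ℤ))).hasDerivAt x
    have h2 := (hasDerivAt_gegenbauerC (ν := ((ν + 1 : ℕ) : ℝ)) (by positivity) j x).const_mul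
      (((j + 1 + (ν + 1) : ℕ) : ℝ) * 2 ^ ν * (ν.factorial : ℝ))
    rw [funext (ih (j + 1))] at h1
    rw [h1.unique h2, Nat.factorial_succ]
    push_cast
    ring

open Set in
theorem Lop_eqOn {f g : ℝ → ℝ} (h : EqOn f g (Ioo 0 Real.pi)) :
    EqOn (Lop f) (Lop g) (Ioo 0 Real.pi) := fun z hz => by
  simp only [Lop, (h.eventuallyEq_of_mem (isOpen_Ioo.mem_nhds hz)).deriv_eq]

open Set in
theorem Lop_iterate_eqOn {f g : ℝ → ℝ} (h : EqOn f g (Ioo 0 Real.pi)) (k : ℕ) :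
    EqOn (Lop^[k] f) (Lop^[k] g) (Ioo 0 Real.pi) := by
  induction k with
  | zero => exact h
  | succ k ih => simpa only [Function.iterate_succ_apply'] using Lop_eqOn ih

open Set ContDiff in
theorem contDiffOn_Lop_iterate {g : ℝ → ℝ} (hg : ContDiffOn ℝ ∞ g (Ioo 0 Real.pi)) (k : ℕ) :
    ContDiffOn ℝ ∞ (Lop^[k] g) (Ioo 0 Real.pi) := by
  induction k with
  | zero => exact hg
  | succ k ih =>
    rw [Function.iterate_succ_apply']
    exact (ih.deriv_of_isOpen isOpen_Ioo (by simp)).neg.div Real.contDiff_sin.contDiffOn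
      fun z hz => (Real.sin_pos_of_mem_Ioo hz).ne'

open Set ContDiff in
theorem Lop_iterate_sum {ι : Type*} (s : Finset ι) (c : ι → ℝ) {g : ι → ℝ → ℝ}
    (hg : ∀ i, ContDiffOn ℝ ∞ (g i) (Ioo 0 Real.pi)) (k : ℕ) :
    EqOn (Lop^[k] fun z => ∑ i ∈ s, c i * g i z) (fun z => ∑ i ∈ s, c i * Lop^[k] (g i) z)
      (Ioo 0 Real.pi) := by
  induction k with
  | zero => exact fun _ _ => rfl
  | succ k ih =>
    intro z hz
    simp only [Function.iterate_succ_apply']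
    rw [Lop_eqOn ih hz]
    have hd (i : ι) : DifferentiableAt ℝ (Lop^[k] (g i)) z :=
      ((contDiffOn_Lop_iterate (hg i) k).contDiffAt (isOpen_Ioo.mem_nhds hz)).differentiableAt
        (by simp)
    simp only [Lop]
    rw [deriv_fun_sum fun i _ => (hd i).const_mul _, ← Finset.sum_neg_distrib, Finset.sum_div]
    exact Finset.sum_congr rfl fun i _ => by rw [deriv_const_mul _ (hd i)]; ring

open Set in
/-- In the variable `x = cos z`, the operator `L` is `d/dx`. -/
theorem Lop_comp_cos {G : ℝ → ℝ} {G' z : ℝ} (hz : z ∈ Ioo 0 Real.pi)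
    (hG : HasDerivAt G G' (Real.cos z)) : Lop (fun z => G (Real.cos z)) z = G' := by
  have hs := (Real.sin_pos_of_mem_Ioo hz).ne'
  have h : HasDerivAt (fun z => G (Real.cos z)) (G' * -Real.sin z) z :=
    hG.comp z (Real.hasDerivAt_cos z)
  rw [Lop, h.deriv]
  field_simp

open Set in
/-- `L` acts termwise on cosine series with superexponentially decaying coefficients. -/
theorem Lop_iterate_tsum_cos {ι : Type*} {a : ι → ℝ} {d : ι → ℤ}
    (ha : ∀ K : ℝ, 1 ≤ K → Summable fun i => |a i| * K ^ (d i).natAbs) (k : ℕ) :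
    EqOn (Lop^[k] fun z => ∑' i, a i * Real.cos (d i * z))
      (fun z => ∑' i, a i * (derivative^[k] (Chebyshev.T ℝ (d i))).eval (Real.cos z))
      (Ioo 0 Real.pi) := by
  have hbound (m : ℕ) (i : ι) (x : ℝ) (hx : x ∈ Ioo (-1 : ℝ) 1) :
      ‖a i * (derivative^[m] (Chebyshev.T ℝ (d i))).eval x‖ ≤
        |a i| * (2 * m + 3 : ℝ) ^ (d i).natAbs := by
    rw [norm_mul, Real.norm_eq_abs, Real.norm_eq_abs]
    exact mul_le_mul_of_nonneg_left
      (abs_eval_iterate_derivative_T_le m (abs_le.2 ⟨hx.1.le, hx.2.le⟩) _) (abs_nonneg _)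
  have hsum (m : ℕ) : Summable fun i => |a i| * (2 * m + 3 : ℝ) ^ (d i).natAbs :=
    ha _ (by have := m.cast_nonneg (α := ℝ); linarith)
  induction k with
  | zero => intro z _; simp [Chebyshev.T_real_cos]
  | succ k ih =>
    intro z hz
    simp only [Function.iterate_succ_apply' Lop]
    rw [Lop_eqOn ih hz]
    have hcos : Real.cos z ∈ Ioo (-1 : ℝ) 1 := by
      constructor
      · rw [← Real.cos_pi]
        exact Real.cos_lt_cos_of_nonneg_of_le_pi hz.1.le le_rfl hz.2
      · rw [← Real.cos_zero]
        exact Real.cos_lt_cos_of_nonneg_of_le_pi le_rfl hz.2.le hz.1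
    refine Lop_comp_cos (G := fun x => ∑' i, a i * (derivative^[k] (Chebyshev.T ℝ (d i))).eval x)
      hz ?_
    refine hasDerivAt_tsum_of_isPreconnected (hsum (k + 1)) isOpen_Ioo isPreconnected_Ioo
      (fun i x _ => ?_) (hbound (k + 1)) hcos
      (.of_norm_bounded (hsum k) fun i => hbound k i _ hcos) hcos
    rw [Function.iterate_succ_apply']
    exact (Polynomial.hasDerivAt _ x).const_mul _

open ContDiff in
theorem contDiffOn_exp_mul_cos (R a b : ℝ) :
    ContDiffOn ℝ ∞ (fun z => Real.exp (R * Real.cos ((z + a) / b))) (Set.Ioo 0 Real.pi) :=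
  ContDiff.contDiffOn (by fun_prop)

theorem sum_pow_Icc_of_pow_eq_one {q : ℂ} {N : ℕ} (hq : q ^ N = 1) :
    ∑ σ ∈ Finset.Icc 1 N, q ^ σ = if q = 1 then (N : ℂ) else 0 := by
  split_ifs with h
  · simp [h]
  · rw [← Finset.Ico_add_one_right_eq_Icc, Finset.sum_Ico_eq_sum_range]
    simp_rw [add_tsub_cancel_right, pow_add, ← Finset.mul_sum]
    rw [geom_sum_eq h, hq]
    simp

/-- The sum over `σ` selects the frequencies `n = p (2 j + ν)`. -/
theorem hasSum_besselI_mul_cos {p : ℕ} (hp : 1 ≤ p) (ν : ℕ) (R z : ℝ) :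
    HasSum (fun j : ℤ => 2 * p * besselI ((p : ℤ) * (2 * j + ν)).natAbs R *
        Real.cos ((2 * j + ν : ℤ) * z))
      (∑ σ ∈ Finset.Icc 1 (2 * p), (-1 : ℝ) ^ (ν * σ) *
        Real.exp (R * Real.cos ((z + (σ : ℝ) * Real.pi) / (p : ℝ)))) := by
  have hp0 : (p : ℂ) ≠ 0 := by exact_mod_cast (by omega : p ≠ 0)
  let w (σ : ℕ) : ℂ := Complex.exp (((z + σ * Real.pi) / p : ℝ) * Complex.I)
  let q (n : ℤ) : ℂ := Complex.exp ((n + p * ν) / p * (Real.pi * Complex.I))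
  have hexp (σ : ℕ) : Complex.exp (R / 2 * (w σ + (w σ)⁻¹)) =
      (Real.exp (R * Real.cos ((z + (σ : ℝ) * Real.pi) / (p : ℝ))) : ℂ) := by
    simp only [w]
    rw [← Complex.exp_neg, ← neg_mul, Complex.ofReal_exp, Complex.ofReal_mul, Complex.ofReal_cos,
      Complex.cos]
    ring_nf
  have hterm (n : ℤ) (σ : ℕ) : (-1 : ℂ) ^ (ν * σ) * w σ ^ n =
      Complex.exp (n * z / p * Complex.I) * q n ^ σ := by
    simp only [w, q]
    rw [← Complex.exp_pi_mul_I, ← Complex.exp_nat_mul, ← Complex.exp_int_mul,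
      ← Complex.exp_nat_mul, ← Complex.exp_add, ← Complex.exp_add]
    congr 1
    push_cast
    field_simp
    ring
  have hq (n : ℤ) : q n ^ (2 * p) = 1 := by
    simp only [q]
    rw [← Complex.exp_nat_mul, Complex.exp_eq_one_iff]
    exact ⟨n + p * ν, by push_cast; field_simp⟩
  have hq1 (n : ℤ) : q n = 1 ↔ ∃ j : ℤ, (p : ℤ) * (2 * j + ν) = n := by
    simp only [q]
    rw [Complex.exp_eq_one_iff]
    have key (m : ℤ) : (n + p * ν) / p * (Real.pi * Complex.I) = m * (2 * Real.pi * Complex.I) ↔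
        n + p * ν = 2 * p * m := by
      have h : ((n : ℂ) + p * ν = 2 * p * m) ↔ n + p * ν = 2 * p * m := by norm_cast
      rw [← h]
      have hI := Complex.I_ne_zero
      field_simp
    constructor
    · rintro ⟨m, hm⟩
      exact ⟨m - ν, by linear_combination -(key m).1 hm⟩
    · rintro ⟨j, hj⟩
      exact ⟨j + ν, (key _).2 (by linear_combination -hj)⟩
  have hall : HasSum (fun n : ℤ => ∑ σ ∈ Finset.Icc 1 (2 * p),
      (-1 : ℂ) ^ (ν * σ) * ((besselI n.natAbs R : ℂ) * w σ ^ n))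
      (∑ σ ∈ Finset.Icc 1 (2 * p),
        (-1 : ℂ) ^ (ν * σ) * Complex.exp (R / 2 * (w σ + (w σ)⁻¹))) := hasSum_sum fun σ _ =>
    (hasSum_besselI_mul_zpow R (Complex.exp_ne_zero _ : w σ ≠ 0)).mul_left ((-1 : ℂ) ^ (ν * σ))
  have hcoeff (n : ℤ) : ∑ σ ∈ Finset.Icc 1 (2 * p),
      (-1 : ℂ) ^ (ν * σ) * ((besselI n.natAbs R : ℂ) * w σ ^ n) =
      (besselI n.natAbs R : ℂ) * Complex.exp (n * z / p * Complex.I) *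
        if q n = 1 then ((2 * p : ℕ) : ℂ) else 0 := by
    rw [← sum_pow_Icc_of_pow_eq_one (hq n), Finset.mul_sum]
    refine Finset.sum_congr rfl fun σ _ => ?_
    rw [mul_assoc, ← hterm]
    ring
  simp only [hcoeff, hexp] at hall
  have hinj : Function.Injective fun j : ℤ => (p : ℤ) * (2 * j + ν) := fun i j hij => by
    have := mul_left_cancel₀ (by omega : (p : ℤ) ≠ 0) hij
    omega
  rw [← hinj.hasSum_iff fun n hn => by
    rw [if_neg fun h => hn ((hq1 n).1 h), mul_zero]] at hall
  have hre := Complex.reCLM.hasSum hall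
  convert! hre using 1
  · funext j
    simp only [Function.comp, Complex.reCLM_apply]
    rw [if_pos ((hq1 _).2 ⟨j, rfl⟩)]
    have h : (((p : ℤ) * (2 * j + ν) : ℤ) : ℂ) * z / p * Complex.I =
        (((2 * j + ν : ℤ) * z : ℝ) : ℂ) * Complex.I := by
      push_cast
      field_simp
    rw [h, show ((2 * p : ℕ) : ℂ) = ((2 * p : ℝ) : ℂ) by push_cast; ring, Complex.re_mul_ofReal,
      Complex.re_ofReal_mul, Complex.exp_ofReal_mul_I_re]
    ring
  · rw [Complex.reCLM_apply, Complex.re_sum]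
    refine Finset.sum_congr rfl fun σ _ => ?_
    rw [← Complex.ofReal_one, ← Complex.ofReal_neg, ← Complex.ofReal_pow, ← Complex.ofReal_mul,
      Complex.ofReal_re]

theorem summable_besselI_mul_pow_of_le {p : ℕ} (hp : 1 ≤ p) (ν : ℕ) (R : ℝ) {K : ℝ} (hK : 1 ≤ K) :
    Summable fun j : ℤ => |2 * p * besselI ((p : ℤ) * (2 * j + ν)).natAbs R| *
      K ^ (2 * j + ν : ℤ).natAbs := by
  have hinj : Function.Injective fun j : ℤ => (p : ℤ) * (2 * j + ν) := fun i j hij => by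
    have := mul_left_cancel₀ (by omega : (p : ℤ) ≠ 0) hij
    omega
  refine .of_nonneg_of_le (fun j => by positivity) (fun j => ?_)
    (((summable_besselI_mul_pow R hK).comp_injective hinj).mul_left (2 * p : ℝ))
  rw [abs_mul, abs_of_nonneg (by positivity : (0 : ℝ) ≤ 2 * p), mul_assoc]
  have hle : (2 * j + ν : ℤ).natAbs ≤ ((p : ℤ) * (2 * j + ν)).natAbs := by
    rw [Int.natAbs_mul, Int.natAbs_natCast]
    exact Nat.le_mul_of_pos_left _ hp
  exact mul_le_mul_of_nonneg_left (mul_le_mul_of_nonneg_left (pow_le_pow_right₀ hK hle)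
    (abs_nonneg _)) (by positivity)

theorem stmt10 (p ν : ℕ) (hp : 1 ≤ p) (hν : 1 ≤ ν) (R : ℝ) (hR : 0 < R)
    (ζ : ℝ) (hζ : ζ ∈ Set.Ioo 0 Real.pi) :
    ∑' j : ℕ, (2 * (j : ℝ) + (ν : ℝ)) *
        besselI ((p : ℝ) * (2 * (j : ℝ) + (ν : ℝ))) R *
        gegenbauerC (ν : ℝ) (2 * j) (Real.cos ζ) =
      (1 / (2 ^ (ν + 1) * (Nat.factorial (ν - 1) : ℝ) * (p : ℝ))) *
        ∑ σ ∈ Finset.Icc 1 (2 * p), (-1 : ℝ) ^ (ν * σ) *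
          Lop^[ν] (fun z => Real.exp (R * Real.cos ((z + (σ : ℝ) * Real.pi) / (p : ℝ)))) ζ := by
  obtain ⟨μ, rfl⟩ : ∃ μ, ν = μ + 1 := ⟨ν - 1, by omega⟩
  set x := Real.cos ζ
  have hL := Lop_iterate_sum (Finset.Icc 1 (2 * p)) (fun σ : ℕ => (-1 : ℝ) ^ ((μ + 1) * σ))
    (fun σ => contDiffOn_exp_mul_cos R (σ * Real.pi) p) (μ + 1) hζ
  simp_rw [← (hasSum_besselI_mul_cos hp (μ + 1) R _).tsum_eq] at hL
  have ha (K : ℝ) (hK : 1 ≤ K) := summable_besselI_mul_pow_of_le hp (μ + 1) R hK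
  rw [Lop_iterate_tsum_cos ha (μ + 1) hζ] at hL
  rw [← hL]
  set F : ℤ → ℝ := fun j => 2 * p * besselI ((p : ℤ) * (2 * j + (μ + 1 : ℕ))).natAbs R *
    (derivative^[μ + 1] (Chebyshev.T ℝ (2 * j + (μ + 1 : ℕ)))).eval x with hF
  have hFsum : Summable F := by
    refine .of_norm_bounded (ha (2 * (μ + 1 : ℕ) + 3) (by linarith [(μ + 1).cast_nonneg (α := ℝ)]))
      fun j => ?_
    rw [norm_mul, Real.norm_eq_abs, Real.norm_eq_abs]
    exact mul_le_mul_of_nonneg_left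
      (abs_eval_iterate_derivative_T_le _ (Real.abs_cos_le_one ζ) _) (abs_nonneg _)
  have hsymm (j : ℤ) : F (-(μ + 1 : ℕ) - j) = F j := by
    have h : 2 * (-((μ + 1 : ℕ) : ℤ) - j) + (μ + 1 : ℕ) = -(2 * j + (μ + 1 : ℕ)) := by ring
    simp only [hF]
    rw [h, Chebyshev.T_neg, mul_neg, Int.natAbs_neg]
  have hzero (n : ℕ) (hn : n < μ) : F (-(n + 1)) = 0 := by
    simp only [hF]
    rw [iterate_derivative_eq_zero (by rw [Chebyshev.natDegree_T]; omega), eval_zero, mul_zero]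
  have hnat (j : ℕ) : F j = (2 ^ (μ + 1) * (μ.factorial : ℝ) * p) *
      ((2 * (j : ℝ) + ((μ + 1 : ℕ) : ℝ)) * besselI ((p : ℝ) * (2 * (j : ℝ) + ((μ + 1 : ℕ) : ℝ))) R *
        gegenbauerC ((μ + 1 : ℕ) : ℝ) (2 * j) x) := by
    have h1 : (2 * (j : ℤ) + (μ + 1 : ℕ)) = ((2 * j + (μ + 1) : ℕ) : ℤ) := by push_cast; ring
    simp only [hF]
    rw [h1, eval_iterate_derivative_T, ← Int.natCast_mul, Int.natAbs_natCast]
    push_cast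
    ring
  have hinj : Function.Injective fun n : ℕ => -((n : ℤ) + 1) := fun a b h => by
    simp only [neg_inj] at h
    omega
  have hneg : ∑' n : ℕ, F (-(n + 1)) = ∑' n : ℕ, F n := by
    have hs : Summable fun n : ℕ => F (-(n + 1)) := hFsum.comp_injective hinj
    rw [← hs.sum_add_tsum_nat_add μ,
      Finset.sum_eq_zero fun n hn => hzero n (Finset.mem_range.1 hn), zero_add]
    refine tsum_congr fun n => ?_
    rw [← hsymm]
    congr 1
    push_cast
    ring
  have hpos : Summable fun n : ℕ => F n := hFsum.comp_injective Nat.cast_injective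
  have hfold : ∑' j : ℤ, F j = 2 * ∑' n : ℕ, F n := by
    rw [tsum_of_nat_of_neg_add_one hpos (hFsum.comp_injective hinj), hneg]
    ring
  change _ = _ * ∑' j : ℤ, F j
  rw [hfold]
  simp_rw [hnat, tsum_mul_left]
  have hp0 : (p : ℝ) ≠ 0 := by exact_mod_cast (by omega : p ≠ 0)
  have hfac : (μ.factorial : ℝ) ≠ 0 := by positivity
  have hc : 1 / (2 ^ (μ + 1 + 1) * (μ.factorial : ℝ) * p) *
      (2 * (2 ^ (μ + 1) * (μ.factorial : ℝ) * p)) = 1 := by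
    field_simp
    ring
  rw [Nat.add_sub_cancel, ← mul_assoc (2 : ℝ) (2 ^ (μ + 1) * (μ.factorial : ℝ) * p), ← mul_assoc,
    hc, one_mul]
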